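/- arXiv:2508.19738 — 5 statements merged into one kernel-verified Lean document; each statement's English description precedes it below -/
import Mathlib

section
/- Let G be a group, θ an automorphism of G with θ ∘ θ = id, H := G^θ, and A a θ-stable subgroup of G. The involution θ acts on the right coset space A\G by A g ↦ A θ(g); let (A\G)^θ denote the set of fixed cosets, on which H acts by right multiplication. Then the assignment A g ↦ [g θ(g)⁻¹] is a well-defined bijection from the orbit space (A\G)^θ / H onto the kernel of H¹(⟨θ⟩, A) → H¹(⟨θ⟩, G), i.e., onto the set of orbits, under twisted conjugation by A, of elements a ∈ A with θ(a) = a⁻¹ such that a = g θ(g)⁻¹ for some g ∈ G. (Note that if A θ(g) = A g then g θ(g)⁻¹ ∈ A.) -/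
namespace SerreSequenceStmt

variable {G : Type*} [Group G]

/-- The fixed-point subgroup `G^θ` of an involution `θ` of `G`. -/
def fixedSubgroup (θ : G ≃* G) : Subgroup G where
  carrier := {g | θ g = g}
  one_mem' := map_one θ
  mul_mem' := by
    intro a b ha hb
    simp only [Set.mem_setOf_eq, map_mul] at *
    rw [ha, hb]
  inv_mem' := by
    intro a ha
    simp only [Set.mem_setOf_eq, map_inv] at *
    rw [ha]

/-- The space of right cosets `A\G`. -/
def RightCosets (A : Subgroup G) : Type _ :=
  Quotient (QuotientGroup.rightRel A)

/-- The right coset `A g`. -/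
def rc (A : Subgroup G) (g : G) : RightCosets A :=
  Quotient.mk (QuotientGroup.rightRel A) g

/-- The set of `θ`-fixed right cosets in `A\G`. -/
def FixedCosets (θ : G ≃* G) (A : Subgroup G) : Type _ :=
  {d : RightCosets A // ∃ g : G, d = rc A g ∧ rc A (θ g) = rc A g}

/-- The orbit space of the `θ`-fixed right cosets under right multiplication by
`H = G^θ`. -/
def FixedCosetsModH (θ : G ≃* G) (A : Subgroup G) : Type _ :=
  Quot (fun d e : FixedCosets θ A =>
    ∃ g h : G, h ∈ fixedSubgroup θ ∧ d.1 = rc A g ∧ e.1 = rc A (g * h))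

/-- The kernel of `H¹(⟨θ⟩, A) → H¹(⟨θ⟩, G)`: the set of orbits, under twisted conjugation
by `A`, of elements `a ∈ A` with `θ(a) = a⁻¹` that are coboundaries in `G`. -/
def kerH1 (θ : G ≃* G) (A : Subgroup G) : Type _ :=
  Quot (fun a b : {a : G // a ∈ A ∧ θ a = a⁻¹ ∧ ∃ g : G, a = g * (θ g)⁻¹} =>
    ∃ q ∈ A, (b : G) = q * a * (θ q)⁻¹)

theorem mem_fixedSubgroup {θ : G ≃* G} {g : G} : g ∈ fixedSubgroup θ ↔ θ g = g :=
  Iff.rfl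

theorem rc_eq_rc {A : Subgroup G} {g g' : G} : rc A g = rc A g' ↔ g' * g⁻¹ ∈ A :=
  Quotient.eq.trans QuotientGroup.rightRel_apply

theorem map_mem_of_map_eq {θ : G ≃* G} {A : Subgroup G} (hA : A.map θ.toMonoidHom = A)
    {a : G} (ha : a ∈ A) : θ a ∈ A :=
  hA.le (Subgroup.mem_map_of_mem θ.toMonoidHom ha)

/-- Every representative `g` of a fixed coset satisfies `g θ(g)⁻¹ ∈ A`. -/
theorem mul_inv_map_mem {θ : G ≃* G} {A : Subgroup G} (hA : A.map θ.toMonoidHom = A) {g : G}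
    (hfix : ∃ g' : G, rc A g = rc A g' ∧ rc A (θ g') = rc A g') : g * (θ g)⁻¹ ∈ A := by
  obtain ⟨g', h, h'⟩ := hfix
  rw [rc_eq_rc] at h h'
  have key := A.mul_mem (A.mul_mem (A.inv_mem h) h') (map_mem_of_map_eq hA h)
  simpa [mul_assoc] using key

theorem map_mul_inv_map {θ : G ≃* G} (hθ : ∀ g, θ (θ g) = g) (g : G) :
    θ (g * (θ g)⁻¹) = (g * (θ g)⁻¹)⁻¹ := by
  simp [hθ]

/-- The class of `g θ(g)⁻¹` in `kerH1 θ A`. -/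
def kerClass {θ : G ≃* G} (hθ : ∀ g, θ (θ g) = g) {A : Subgroup G} (g : G)
    (hg : g * (θ g)⁻¹ ∈ A) : kerH1 θ A :=
  Quot.mk _ ⟨g * (θ g)⁻¹, hg, map_mul_inv_map hθ g, g, rfl⟩

/-- Two elements have the same class in `kerH1 θ A` iff their cosets are related by `G^θ`. -/
theorem kerClass_eq_iff {θ : G ≃* G} (hθ : ∀ g, θ (θ g) = g) {A : Subgroup G} {g g' : G}
    (hg : g * (θ g)⁻¹ ∈ A) (hg' : g' * (θ g')⁻¹ ∈ A) :
    kerClass hθ g hg = kerClass hθ g' hg' ↔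
      ∃ q ∈ A, ∃ h ∈ fixedSubgroup θ, g' = q * g * h := by
  refine (Equivalence.quot_mk_eq_iff ⟨fun a => ⟨1, A.one_mem, by simp⟩, ?_, ?_⟩ _ _).trans ?_
  · rintro a b ⟨q, hq, h⟩
    exact ⟨q⁻¹, A.inv_mem hq, by simp [h, mul_assoc]⟩
  · rintro a b c ⟨q, hq, h⟩ ⟨r, hr, h'⟩
    exact ⟨r * q, A.mul_mem hr hq, by simp [h, h', mul_assoc]⟩
  · refine exists_congr fun q => and_congr_right fun _ => ⟨fun h => ?_, ?_⟩
    · refine ⟨(q * g)⁻¹ * g', ?_, by group⟩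
      have h' : g' = q * g * (θ g)⁻¹ * (θ q)⁻¹ * θ g' := by
        rw [← mul_inv_eq_iff_eq_mul]
        simpa [mul_assoc] using h
      rw [mem_fixedSubgroup]
      conv_rhs => rw [h']
      simp [mul_assoc]
    · rintro ⟨h, hh, rfl⟩
      rw [mem_fixedSubgroup] at hh
      simp [hh, mul_assoc]

theorem exists_rc_eq {θ : G ≃* G} {A : Subgroup G} (d : FixedCosets θ A) :
    ∃ g : G, d.1 = rc A g :=
  d.2.imp fun _ h => h.1

/-- The map `A g ↦ [g θ(g)⁻¹]` on fixed cosets. -/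
noncomputable def fixedCosetClass {θ : G ≃* G} (hθ : ∀ g, θ (θ g) = g) {A : Subgroup G}
    (hA : A.map θ.toMonoidHom = A) (d : FixedCosets θ A) : kerH1 θ A :=
  kerClass hθ (exists_rc_eq d).choose
    (mul_inv_map_mem hA ((exists_rc_eq d).choose_spec ▸ d.2))

theorem fixedCosetClass_eq {θ : G ≃* G} (hθ : ∀ g, θ (θ g) = g) {A : Subgroup G}
    (hA : A.map θ.toMonoidHom = A) (d : FixedCosets θ A) {g : G} (hd : d.1 = rc A g)
    (hg : g * (θ g)⁻¹ ∈ A) : fixedCosetClass hθ hA d = kerClass hθ g hg := by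
  refine (kerClass_eq_iff hθ _ hg).2 ⟨g * (exists_rc_eq d).choose⁻¹, ?_, 1, one_mem _, by simp⟩
  exact rc_eq_rc.1 ((exists_rc_eq d).choose_spec.symm.trans hd)

/-- For a `θ`-stable subgroup `A ≤ G`, the assignment `A g ↦ [g θ(g)⁻¹]` is a well-defined
bijection from `(A\G)^θ / H` onto the kernel of `H¹(⟨θ⟩, A) → H¹(⟨θ⟩, G)`. -/
theorem fixed_cosets_mod_H_equiv_kerH1 (θ : G ≃* G) (hθ : ∀ g, θ (θ g) = g)
    (A : Subgroup G) (hA : A.map θ.toMonoidHom = A) :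
    ∃ F : FixedCosetsModH θ A → kerH1 θ A,
      Function.Bijective F ∧
        ∀ (g : G) (hfix : ∃ g' : G, rc A g = rc A g' ∧ rc A (θ g') = rc A g')
          (hker : g * (θ g)⁻¹ ∈ A ∧ θ (g * (θ g)⁻¹) = (g * (θ g)⁻¹)⁻¹ ∧
            ∃ g₀ : G, g * (θ g)⁻¹ = g₀ * (θ g₀)⁻¹),
          F (Quot.mk _ ⟨rc A g, hfix⟩) = Quot.mk _ ⟨g * (θ g)⁻¹, hker⟩ := by
  have hmem (d : FixedCosets θ A) {g : G} (hd : d.1 = rc A g) : g * (θ g)⁻¹ ∈ A :=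
    mul_inv_map_mem hA (hd ▸ d.2)
  refine ⟨Quot.lift (fixedCosetClass hθ hA) ?_, ⟨?_, ?_⟩, ?_⟩
  · rintro d e ⟨g, h, hh, hd, he⟩
    rw [fixedCosetClass_eq hθ hA d hd (hmem d hd), fixedCosetClass_eq hθ hA e he (hmem e he),
      kerClass_eq_iff]
    exact ⟨1, A.one_mem, h, hh, by simp⟩
  · rintro ⟨d⟩ ⟨e⟩ hde
    obtain ⟨g, hd⟩ := exists_rc_eq d
    obtain ⟨g', he⟩ := exists_rc_eq e
    change fixedCosetClass hθ hA d = fixedCosetClass hθ hA e at hde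
    rw [fixedCosetClass_eq hθ hA d hd (hmem d hd), fixedCosetClass_eq hθ hA e he (hmem e he),
      kerClass_eq_iff] at hde
    obtain ⟨q, hq, h, hh, rfl⟩ := hde
    exact Quot.sound ⟨q * g, h, hh, hd.trans (rc_eq_rc.2 (by simpa using hq)), he⟩
  · rintro ⟨⟨_, ha, -, g, rfl⟩⟩
    exact ⟨Quot.mk _ ⟨rc A g, g, rfl, rc_eq_rc.2 ha⟩, fixedCosetClass_eq hθ hA _ rfl ha⟩
  · intro g hfix hker
    exact fixedCosetClass_eq hθ hA _ rfl hker.1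

end SerreSequenceStmt
end

section
/- Let F be a finite field of odd characteristic and let θ be an automorphism of the multiplicative group Fˣ with θ ∘ θ = id. Then H¹(⟨θ⟩, Fˣ) has at most 2 elements; that is, the quotient of {x ∈ Fˣ : θ(x) = x⁻¹} by the equivalence relation x ~ g x θ(g)⁻¹ (g ∈ Fˣ) has at most 2 elements. -/
/-- The subgroup of elements of a commutative group that an endomorphism `θ` inverts. -/
def invertedSubgroup {G : Type*} [CommGroup G] (θ : G →* G) : Subgroup G where
  carrier := {x | θ x = x⁻¹}
  one_mem' := by simp
  mul_mem' {x y} hx hy := by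
    simp only [Set.mem_ofPred_eq] at *
    rw [map_mul, hx, hy, mul_inv]
  inv_mem' {x} hx := by
    simp only [Set.mem_ofPred_eq] at *
    rw [map_inv, hx]

/-- In a cyclic group, every element inverted by `θ` is a twisted conjugate of `1` or of a fixed
generator of the subgroup of inverted elements. -/
theorem exists_twisted_conj_of_isCyclic {G : Type*} [CommGroup G] [IsCyclic G] (θ : G →* G) :
    ∃ z : G, θ z = z⁻¹ ∧ ∀ x, θ x = x⁻¹ →
      (∃ g, x = g * 1 * (θ g)⁻¹) ∨ ∃ g, x = g * z * (θ g)⁻¹ := by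
  obtain ⟨⟨z, hz⟩, hgen⟩ := IsCyclic.exists_generator (α := invertedSubgroup θ)
  have hθz : θ z = z⁻¹ := hz
  refine ⟨z, hθz, fun x hx => ?_⟩
  obtain ⟨m, hm⟩ := Subgroup.mem_zpowers_iff.mp (hgen ⟨x, hx⟩)
  have hxm : z ^ m = x := congrArg Subtype.val hm
  have hθpow (j : ℤ) : (θ (z ^ j))⁻¹ = z ^ j := by rw [map_zpow, hθz, inv_zpow, inv_inv]
  obtain ⟨j, rfl | rfl⟩ := m.even_or_odd'
  · left
    exact ⟨z ^ j, by rw [hθpow, mul_one, ← hxm, two_mul, zpow_add]⟩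
  · right
    exact ⟨z ^ j, by rw [hθpow, ← hxm, two_mul, zpow_add_one, zpow_add, mul_right_comm]⟩

/-- For a finite field `F` of odd characteristic and any involution `θ` of the multiplicative
group `Fˣ`, the first cohomology `H¹(⟨θ⟩, Fˣ)` — the quotient of `{x : Fˣ | θ x = x⁻¹}` by
twisted conjugation `x ~ g x θ(g)⁻¹` — has at most two elements. -/
theorem h1_finite_field_units_card_le_two (F : Type*) [Field F] [Fintype F]
    (p : ℕ) (hp : p.Prime) (hodd : Odd p) [CharP F p]
    (θ : Fˣ ≃* Fˣ) (hθ : ∀ x, θ (θ x) = x) :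
    ∃ a b : Quot (fun x y : {x : Fˣ // θ x = x⁻¹} => ∃ g : Fˣ, (y : Fˣ) = g * x * (θ g)⁻¹),
      ∀ c, c = a ∨ c = b := by
  obtain ⟨z, hz, h⟩ := exists_twisted_conj_of_isCyclic θ.toMonoidHom
  refine ⟨Quot.mk _ ⟨1, by simp⟩, Quot.mk _ ⟨z, hz⟩, ?_⟩
  rintro ⟨x, hx⟩
  exact (h x hx).imp (fun hg => (Quot.sound hg).symm) (fun hg => (Quot.sound hg).symm)
end

section
/- Let p be an odd prime and let θ be an automorphism of the group ℤ_pˣ of units of the ring ℤ_p of p-adic integers, with θ ∘ θ = id, such that θ is a homeomorphism with respect to the topology induced from ℤ_p. Then H¹(⟨θ⟩, ℤ_pˣ) has at most 2 elements; that is, the quotient of {x ∈ ℤ_pˣ : θ(x) = x⁻¹} by the equivalence relation x ~ g x θ(g)⁻¹ (g ∈ ℤ_pˣ) has at most 2 elements. -/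
/-- A `p`-adic unit congruent to `1` modulo `p` has an `n`-th root for every `n` prime to `p`. -/
lemma PadicInt.exists_units_pow_eq_of_toZMod_eq_one {p : ℕ} [Fact p.Prime] {n : ℕ}
    (hn : n.Coprime p) {u : ℤ_[p]ˣ} (hu : PadicInt.toZMod (u : ℤ_[p]) = 1) :
    ∃ w : ℤ_[p]ˣ, w ^ n = u := by
  have hn0 : n ≠ 0 := by
    rintro rfl
    exact (Fact.out : p.Prime).one_lt.ne' (by simpa using hn)
  have hnorm : ‖(n : ℤ_[p])‖ = 1 := PadicInt.norm_natCast_eq_one_iff.2 hn.symm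
  have hu' : ‖(1 : ℤ_[p]) - u‖ < 1 := by
    rw [← PadicInt.mem_nonunits, ← IsLocalRing.mem_maximalIdeal, ← PadicInt.ker_toZMod,
      RingHom.mem_ker, map_sub, map_one, hu, sub_self]
  obtain ⟨z, hz, -⟩ := hensels_lemma
    (F := (Polynomial.X ^ n - Polynomial.C (u : ℤ_[p]) : Polynomial ℤ_[p])) (a := (1 : ℤ_[p]))
    (by simpa [hnorm, Polynomial.derivative_X_pow] using hu')
  have hz' : z ^ n = u := by simpa [sub_eq_zero] using hz
  have hzu : IsUnit z := (isUnit_pow_iff hn0).1 (hz' ▸ u.isUnit)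
  exact ⟨hzu.unit, Units.ext (by simpa using hz')⟩

/-- A `p`-adic unit, `p` odd, whose `2 (p - 1)`-th power is `1` is a `(p - 1)`-th root of unity. -/
lemma PadicInt.units_pow_sub_one_eq_one {p : ℕ} [Fact p.Prime] (hodd : Odd p) {s : ℤ_[p]ˣ}
    (hs : (s ^ (p - 1)) ^ 2 = 1) : s ^ (p - 1) = 1 := by
  have hs' : ((s ^ (p - 1) : ℤ_[p]ˣ) : ℤ_[p]) ^ 2 = 1 := by
    rw [← Units.val_pow_eq_pow_val, hs, Units.val_one]
  rcases sq_eq_one_iff.1 hs' with h | h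
  · exact Units.ext h
  · have hmod : Units.map (PadicInt.toZMod (p := p)).toMonoidHom (s ^ (p - 1)) = 1 := by
      rw [map_pow, ZMod.units_pow_card_sub_one_eq_one]
    have hmod' : PadicInt.toZMod ((s ^ (p - 1) : ℤ_[p]ˣ) : ℤ_[p]) = 1 :=
      congrArg Units.val hmod
    rw [h, map_neg, map_one] at hmod'
    have : Fact (2 < p) := ⟨by
      have := (Fact.out : p.Prime).two_le
      rcases hodd with ⟨k, rfl⟩
      omega⟩
    exact absurd hmod' (ZMod.neg_one_ne_one)

/-- For an automorphism `θ` of `ℤ_pˣ` with `p` odd, every cocycle congruent to `1` modulo `p` is a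
coboundary. -/
lemma PadicInt.exists_eq_mul_inv_map_of_toZMod_eq_one {p : ℕ} [Fact p.Prime] (hodd : Odd p)
    (θ : ℤ_[p]ˣ ≃* ℤ_[p]ˣ) {u : ℤ_[p]ˣ} (hθu : θ u = u⁻¹)
    (hu : PadicInt.toZMod (u : ℤ_[p]) = 1) : ∃ g : ℤ_[p]ˣ, u = g * (θ g)⁻¹ := by
  have hp : p.Prime := Fact.out
  have hcop : ((p - 1) * 2).Coprime p := by
    refine Nat.Coprime.mul_left ?_ (Nat.coprime_two_left.2 hodd)
    exact (Nat.coprime_of_lt_prime (Nat.sub_pos_of_lt hp.one_lt).ne'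
      (Nat.sub_lt hp.pos one_pos) hp).symm
  obtain ⟨w, rfl⟩ := PadicInt.exists_units_pow_eq_of_toZMod_eq_one hcop hu
  have hw : ((w * θ w) ^ (p - 1)) ^ 2 = 1 := by
    rw [← pow_mul, mul_pow, ← map_pow, hθu, mul_inv_cancel]
  have hw' := PadicInt.units_pow_sub_one_eq_one hodd hw
  rw [mul_pow, ← map_pow] at hw'
  refine ⟨w ^ (p - 1), ?_⟩
  rw [inv_eq_of_mul_eq_one_left hw', pow_mul, sq]

/-- For an odd prime `p` and any continuous involution `θ` of the unit group `ℤ_pˣ` of the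
`p`-adic integers, the first cohomology `H¹(⟨θ⟩, ℤ_pˣ)` — the quotient of
`{x : ℤ_pˣ | θ x = x⁻¹}` by twisted conjugation `x ~ g x θ(g)⁻¹` — has at most two
elements. -/
theorem h1_padic_int_units_card_le_two (p : ℕ) [Fact p.Prime] (hodd : Odd p)
    (θ : ℤ_[p]ˣ ≃* ℤ_[p]ˣ) (hθ : ∀ x, θ (θ x) = x) (hcont : Continuous ⇑θ) :
    ∃ a b : Quot (fun x y : {x : ℤ_[p]ˣ // θ x = x⁻¹} =>
        ∃ g : ℤ_[p]ˣ, (y : ℤ_[p]ˣ) = g * x * (θ g)⁻¹),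
      ∀ c, c = a ∨ c = b := by
  let r : ℤ_[p]ˣ →* (ZMod p)ˣ := Units.map (PadicInt.toZMod (p := p)).toMonoidHom
  let Z : Subgroup ℤ_[p]ˣ := MonoidHom.eqLocus θ.toMonoidHom (invMonoidHom : ℤ_[p]ˣ →* ℤ_[p]ˣ)
  obtain ⟨⟨_, z, hz, rfl⟩, hgen⟩ := IsCyclic.exists_generator (α := Z.map r)
  replace hz : θ z = z⁻¹ := hz
  refine ⟨Quot.mk _ ⟨1, by simp⟩, Quot.mk _ ⟨z, hz⟩, ?_⟩
  rintro ⟨x, hx⟩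
  obtain ⟨k, hk⟩ := Subgroup.mem_zpowers_iff.1 (hgen ⟨r x, x, hx, rfl⟩)
  replace hk : r z ^ k = r x := congrArg Subtype.val hk
  obtain ⟨g, hg⟩ := PadicInt.exists_eq_mul_inv_map_of_toZMod_eq_one hodd θ
    (u := x * (z ^ k)⁻¹) (by simp [hx, hz, mul_comm])
    (congrArg Units.val (show r (x * (z ^ k)⁻¹) = 1 by simp [hk]))
  rw [mul_inv_eq_iff_eq_mul] at hg
  obtain ⟨m, rfl | rfl⟩ := k.even_or_odd'
  · refine Or.inl (Quot.sound ⟨g * z ^ m, ?_⟩).symm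
    simp only [hg, map_mul, map_zpow, hz, two_mul, zpow_add, mul_inv_rev, inv_zpow, inv_inv]
    simp only [mul_comm, mul_left_comm, mul_assoc, mul_one]
  · refine Or.inr (Quot.sound ⟨g * z ^ m, ?_⟩).symm
    simp only [hg, map_mul, map_zpow, hz, two_mul, zpow_add, mul_inv_rev, inv_zpow, inv_inv,
      zpow_one]
    simp only [mul_comm, mul_left_comm, mul_assoc]
end

section
/- Let p be an odd prime and let θ be an automorphism of the multiplicative group ℚ_pˣ with θ ∘ θ = id, such that θ is a homeomorphism with respect to the topology induced from ℚ_p. Then H¹(⟨θ⟩, ℚ_pˣ) has at most 4 elements; that is, the quotient of {x ∈ ℚ_pˣ : θ(x) = x⁻¹} by the equivalence relation x ~ g x θ(g)⁻¹ (g ∈ ℚ_pˣ) has at most 4 elements. -/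
/-- The inclusion of the unit group of `ℤ_[p]` into the unit group of `ℚ_[p]`. -/
noncomputable def padicIntUnitsHom (p : ℕ) [Fact p.Prime] : ℤ_[p]ˣ →* ℚ_[p]ˣ :=
  Units.map (PadicInt.Coe.ringHom (p := p) : ℤ_[p] →* ℚ_[p])

/-- The valuation of `ℚ_[p]`, as a homomorphism on units. -/
noncomputable def padicUnitsValuation (p : ℕ) [Fact p.Prime] :
    ℚ_[p]ˣ →* Multiplicative ℤ where
  toFun x := Multiplicative.ofAdd (x : ℚ_[p]).valuation
  map_one' := by simp
  map_mul' x y := by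
    rw [Units.val_mul, Padic.valuation_mul x.ne_zero y.ne_zero, ofAdd_add]

theorem exists_padicIntUnitsHom_eq_of_norm_eq_one {p : ℕ} [Fact p.Prime] {x : ℚ_[p]ˣ}
    (hx : ‖(x : ℚ_[p])‖ = 1) : ∃ u, padicIntUnitsHom p u = x :=
  ⟨PadicInt.mkUnits hx, Units.ext rfl⟩

theorem exists_padicIntUnitsHom_eq_of_valuation_eq_one {p : ℕ} [Fact p.Prime] {x : ℚ_[p]ˣ}
    (hx : padicUnitsValuation p x = 1) : ∃ u, padicIntUnitsHom p u = x := by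
  have hv : (x : ℚ_[p]).valuation = 0 := hx
  apply exists_padicIntUnitsHom_eq_of_norm_eq_one
  rw [Padic.norm_eq_zpow_neg_valuation x.ne_zero, hv]
  simp

theorem padicInt_norm_natCast_two_mul_pred {p : ℕ} [hp : Fact p.Prime] (hodd : Odd p) :
    ‖((2 * (p - 1) : ℕ) : ℤ_[p])‖ = 1 := by
  rw [PadicInt.norm_natCast_eq_one_iff]
  have h1 := hp.out.two_le
  refine Nat.Coprime.mul_right ?_ ?_
  · exact Nat.Coprime.symm (Nat.coprime_two_left.mpr hodd)
  · exact Nat.coprime_of_lt_prime (by omega) (by omega) hp.out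

/-- A principal unit of `ℤ_[p]`, `p` odd, is a `2 (p - 1)`-th power. -/
theorem exists_pow_two_mul_pred_eq {p : ℕ} [hp : Fact p.Prime] (hodd : Odd p) (u : ℤ_[p]ˣ)
    (hu : Units.map (PadicInt.toZMod (p := p) : ℤ_[p] →* ZMod p) u = 1) :
    ∃ w : ℤ_[p]ˣ, w ^ (2 * (p - 1)) = u := by
  have hu' : PadicInt.toZMod (u : ℤ_[p]) = 1 := congrArg Units.val hu
  have hn : 2 * (p - 1) ≠ 0 := by have := hp.out.two_le; omega
  have hlt : ‖(1 - u : ℤ_[p])‖ < 1 := by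
    have hmem : (1 - u : ℤ_[p]) ∈ RingHom.ker (PadicInt.toZMod (p := p)) := by
      simp [RingHom.mem_ker, hu']
    rw [PadicInt.ker_toZMod] at hmem
    exact PadicInt.mem_nonunits.mp hmem
  obtain ⟨z, hz, -⟩ := hensels_lemma
    (F := (Polynomial.X ^ (2 * (p - 1)) - Polynomial.C (u : ℤ_[p]) : Polynomial ℤ_[p]))
    (a := (1 : ℤ_[p]))
    (by
      have hd := padicInt_norm_natCast_two_mul_pred hodd
      simpa [-Nat.cast_mul, Polynomial.derivative_X_pow, hd] using hlt)
  have hz' : z ^ (2 * (p - 1)) = u := by simpa [sub_eq_zero] using hz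
  have hzu : IsUnit z := (isUnit_pow_iff hn).mp (hz' ▸ u.isUnit)
  exact ⟨hzu.unit, Units.ext (by simpa using hz')⟩

/-- The group of roots of unity of order dividing `2 (p - 1)` in `ℚ_[p]`, `p` odd, has exponent
dividing `p - 1`. -/
theorem pow_pred_eq_one_of_pow_two_mul_pred_eq_one {p : ℕ} [hp : Fact p.Prime] (hodd : Odd p)
    {t : ℚ_[p]ˣ} (ht : t ^ (2 * (p - 1)) = 1) : t ^ (p - 1) = 1 := by
  have hn : 2 * (p - 1) ≠ 0 := by have := hp.out.two_le; omega
  have hnorm : ‖(t : ℚ_[p])‖ = 1 := by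
    have h := congrArg (fun x : ℚ_[p]ˣ => ‖(x : ℚ_[p])‖) ht
    simp only [Units.val_pow_eq_pow_val, norm_pow, Units.val_one, norm_one] at h
    exact (pow_eq_one_iff_of_nonneg (norm_nonneg _) hn).mp h
  obtain ⟨s, rfl⟩ := exists_padicIntUnitsHom_eq_of_norm_eq_one hnorm
  have hinj : Function.Injective (padicIntUnitsHom p) :=
    Units.map_injective Subtype.val_injective
  rw [← map_pow] at ht ⊢
  have hs : s ^ (2 * (p - 1)) = 1 := hinj (by rw [ht, map_one])
  have hsq : ((s : ℤ_[p]) ^ (p - 1)) ^ 2 = 1 := by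
    rw [← pow_mul, mul_comm, ← Units.val_pow_eq_pow_val, hs, Units.val_one]
  rcases sq_eq_one_iff.mp hsq with h | h
  · rw [show s ^ (p - 1) = 1 from Units.ext (by simpa using h), map_one]
  · exfalso
    have hred := ZMod.units_pow_card_sub_one_eq_one p
      (Units.map (PadicInt.toZMod (p := p) : ℤ_[p] →* ZMod p) s)
    have h1 := congrArg Units.val hred
    have h2 := congrArg (PadicInt.toZMod (p := p)) h
    simp only [map_pow, map_neg, map_one] at h2
    simp only [Units.val_pow_eq_pow_val, Units.coe_map, Units.val_one, MonoidHom.coe_coe] at h1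
    rw [h1] at h2
    have : Fact (2 < p) := ⟨by
      have := hp.out.two_le
      rcases hodd with ⟨k, hk⟩
      omega⟩
    exact ZMod.neg_one_ne_one h2.symm

/-- A principal unit inverted by an automorphism of `ℚ_[p]ˣ` is the square of an element that is
also inverted by it. -/
theorem exists_sq_eq_of_map_eq_inv {p : ℕ} [Fact p.Prime] (hodd : Odd p)
    (θ : ℚ_[p]ˣ →* ℚ_[p]ˣ) {u : ℤ_[p]ˣ}
    (hu : Units.map (PadicInt.toZMod (p := p) : ℤ_[p] →* ZMod p) u = 1)
    (hθu : θ (padicIntUnitsHom p u) = (padicIntUnitsHom p u)⁻¹) :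
    ∃ y, θ y = y⁻¹ ∧ y ^ 2 = padicIntUnitsHom p u := by
  obtain ⟨w, rfl⟩ := exists_pow_two_mul_pred_eq hodd u hu
  set x := padicIntUnitsHom p w
  rw [map_pow, map_pow] at hθu
  refine ⟨x ^ (p - 1), ?_, by rw [map_pow, ← pow_mul, mul_comm]⟩
  rw [eq_inv_iff_mul_eq_one, map_pow, ← mul_pow]
  apply pow_pred_eq_one_of_pow_two_mul_pred_eq_one hodd
  rw [mul_pow, hθu, inv_mul_cancel]

/-- A subgroup of `ℚ_[p]ˣ` is generated by two of its elements together with the principal units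
it contains. -/
theorem exists_eq_zpow_mul_zpow_mul_principal_unit {p : ℕ} [Fact p.Prime]
    (Z : Subgroup ℚ_[p]ˣ) :
    ∃ a ∈ Z, ∃ b ∈ Z, ∀ z ∈ Z, ∃ (m n : ℤ) (u : ℤ_[p]ˣ),
      Units.map (PadicInt.toZMod (p := p) : ℤ_[p] →* ZMod p) u = 1 ∧
        z = a ^ m * b ^ n * padicIntUnitsHom p u := by
  obtain ⟨⟨_, a, ha, rfl⟩, hag⟩ :=
    IsCyclic.exists_generator (α := Z.map (padicUnitsValuation p))
  obtain ⟨⟨_, k, hk, rfl⟩, hkg⟩ := IsCyclic.exists_generator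
    (α := (Z.comap (padicIntUnitsHom p)).map
      (Units.map (PadicInt.toZMod (p := p) : ℤ_[p] →* ZMod p)))
  refine ⟨a, ha, padicIntUnitsHom p k, hk, fun z hz => ?_⟩
  obtain ⟨m, hm⟩ := hag ⟨_, z, hz, rfl⟩
  have hm' : padicUnitsValuation p a ^ m = padicUnitsValuation p z := congrArg Subtype.val hm
  obtain ⟨s, hs⟩ := exists_padicIntUnitsHom_eq_of_valuation_eq_one (x := (a ^ m)⁻¹ * z)
    (by rw [map_mul, map_inv, map_zpow, hm', inv_mul_cancel])
  have hsZ : s ∈ Z.comap (padicIntUnitsHom p) := by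
    rw [Subgroup.mem_comap, hs]
    exact Z.mul_mem (Z.inv_mem (Z.zpow_mem ha m)) hz
  obtain ⟨n, hn⟩ := hkg ⟨_, s, hsZ, rfl⟩
  have hn' : Units.map (PadicInt.toZMod (p := p) : ℤ_[p] →* ZMod p) k ^ n = Units.map _ s :=
    congrArg Subtype.val hn
  refine ⟨m, n, (k ^ n)⁻¹ * s, ?_, ?_⟩
  · rw [map_mul, map_inv, map_zpow, hn', inv_mul_cancel]
  · rw [map_mul, map_inv, map_zpow, hs]
    group

/-- For an odd prime `p` and any continuous involution `θ` of the multiplicative group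
`ℚ_pˣ`, the first cohomology `H¹(⟨θ⟩, ℚ_pˣ)` — the quotient of `{x : ℚ_pˣ | θ x = x⁻¹}` by
twisted conjugation `x ~ g x θ(g)⁻¹` — has at most four elements. -/
theorem h1_padic_units_card_le_four (p : ℕ) [Fact p.Prime] (hodd : Odd p)
    (θ : ℚ_[p]ˣ ≃* ℚ_[p]ˣ) (hθ : ∀ x, θ (θ x) = x) (hcont : Continuous ⇑θ) :
    ∃ a b c d : Quot (fun x y : {x : ℚ_[p]ˣ // θ x = x⁻¹} =>
        ∃ g : ℚ_[p]ˣ, (y : ℚ_[p]ˣ) = g * x * (θ g)⁻¹),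
      ∀ e, e = a ∨ e = b ∨ e = c ∨ e = d := by
  let Z : Subgroup ℚ_[p]ˣ := MonoidHom.eqLocus θ.toMonoidHom (invMonoidHom : ℚ_[p]ˣ →* ℚ_[p]ˣ)
  obtain ⟨a, ha, b, hb, hab⟩ := exists_eq_zpow_mul_zpow_mul_principal_unit Z
  refine ⟨Quot.mk _ ⟨1, Z.one_mem⟩, Quot.mk _ ⟨a, ha⟩, Quot.mk _ ⟨b, hb⟩,
    Quot.mk _ ⟨a * b, Z.mul_mem ha hb⟩, ?_⟩
  rintro ⟨z, hz⟩
  obtain ⟨m, n, u, hu, rfl⟩ := hab z hz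
  have huZ : padicIntUnitsHom p u ∈ Z :=
    (Z.mul_mem_cancel_left (Z.mul_mem (Z.zpow_mem ha m) (Z.zpow_mem hb n))).mp hz
  obtain ⟨y, hy, hyu⟩ := exists_sq_eq_of_map_eq_inv hodd θ.toMonoidHom hu huZ
  have hsq : ∀ i j : ℤ, ∃ g, θ g = g⁻¹ ∧
      a ^ (i + i) * b ^ (j + j) * padicIntUnitsHom p u = g * g := fun i j =>
    ⟨a ^ i * b ^ j * y, Z.mul_mem (Z.mul_mem (Z.zpow_mem ha i) (Z.zpow_mem hb j)) hy, by
      rw [← hyu, zpow_add, zpow_add, sq]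
      simp only [mul_comm, mul_left_comm, mul_assoc]⟩
  rcases Int.even_or_odd' m with ⟨i, rfl | rfl⟩ <;> rcases Int.even_or_odd' n with ⟨j, rfl | rfl⟩ <;>
    obtain ⟨g, hg, hgg⟩ := hsq i j <;> rw [← two_mul, ← two_mul] at hgg
  · refine Or.inl (Quot.sound ⟨g, ?_⟩).symm
    simp only [hg, inv_inv, hgg, mul_one]
  · refine Or.inr (Or.inr (Or.inl (Quot.sound ⟨g, ?_⟩).symm))
    simp only [hg, inv_inv]
    rw [mul_right_comm g, ← hgg, zpow_add_one]
    simp only [mul_comm, mul_left_comm, mul_assoc]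
  · refine Or.inr (Or.inl (Quot.sound ⟨g, ?_⟩).symm)
    simp only [hg, inv_inv]
    rw [mul_right_comm g, ← hgg, zpow_add_one]
    simp only [mul_comm, mul_assoc]
  · refine Or.inr (Or.inr (Or.inr (Quot.sound ⟨g, ?_⟩).symm))
    simp only [hg, inv_inv]
    rw [mul_right_comm g, ← hgg, zpow_add_one, zpow_add_one]
    simp only [mul_comm, mul_left_comm, mul_assoc]
end

section
/- Let p be an odd prime and n ≥ 1 an integer. Let Γ be the kernel of the reduction homomorphism GL_n(ℤ_p) → GL_n(ℤ/pℤ) obtained by reducing matrix entries modulo p (so Γ consists of the invertible n×n matrices over ℤ_p congruent to the identity matrix modulo p). Let θ be an automorphism of Γ with θ ∘ θ = id which is a homeomorphism for the topology on Γ induced from GL_n(ℤ_p). Then every x ∈ Γ with θ(x) = x⁻¹ is of the form x = g θ(g)⁻¹ for some g ∈ Γ. -/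
open scoped Matrix

/-- The reduction-mod-`p` homomorphism `GL_n(ℤ_p) →* GL_n(ℤ/pℤ)`. -/
noncomputable def glReduction (p : ℕ) [Fact p.Prime] (n : ℕ) :
    GL (Fin n) ℤ_[p] →* GL (Fin n) (ZMod p) :=
  Units.map (RingHom.mapMatrix (PadicInt.toZMod (p := p))).toMonoidHom

open Filter Topology

theorem exists_pow_prime_pow_eq_one_add {R : Type*} [Ring R] {p : ℕ} (hp : p.Prime) (B : R)
    (k : ℕ) : ∃ C : R, (1 + (p : R) * B) ^ p ^ k = 1 + (p : R) ^ (k + 1) * C := by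
  induction k with
  | zero => exact ⟨B, by simp⟩
  | succ k ih =>
    obtain ⟨C, hC⟩ := ih
    obtain ⟨r, hr⟩ := (Commute.one_left ((p : R) ^ (k + 1) * C)).exists_add_pow_prime_eq hp
    obtain ⟨m, hm⟩ : ∃ m, (k + 1) * p = k + 1 + 1 + m :=
      Nat.exists_eq_add_of_le (by nlinarith [hp.two_le])
    have hc : Commute ((p : R) ^ (k + 1)) C := (Nat.cast_commute p C).pow_left _
    refine ⟨(p : R) ^ m * C ^ p + C * r, ?_⟩
    rw [pow_succ p k, pow_mul, hC, hr, hc.mul_pow, ← pow_mul, hm, pow_add _ (k + 1 + 1) m,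
      pow_succ' (p : R) (k + 1)]
    simp only [one_pow, one_mul, mul_add, mul_assoc, add_assoc]

theorem tendsto_pow_prime_pow_one {p : ℕ} [Fact p.Prime] {n : ℕ}
    (B : Matrix (Fin n) (Fin n) ℤ_[p]) :
    Tendsto (fun k : ℕ ↦ (1 + (p : Matrix (Fin n) (Fin n) ℤ_[p]) * B) ^ p ^ k) atTop (𝓝 1) := by
  choose C hC using exists_pow_prime_pow_eq_one_add (Fact.out : p.Prime) B
  simp_rw [hC]
  suffices h : Tendsto (fun k : ℕ ↦ (p : Matrix (Fin n) (Fin n) ℤ_[p]) ^ (k + 1) * C k)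
      atTop (𝓝 0) by simpa using h.const_add 1
  refine tendsto_pi_nhds.2 fun i ↦ tendsto_pi_nhds.2 fun j ↦ ?_
  have hp : ‖(p : ℤ_[p])‖ < 1 := (PadicInt.norm_lt_one_iff_dvd _).2 dvd_rfl
  refine squeeze_zero_norm (a := fun k ↦ ‖(p : ℤ_[p])‖ ^ (k + 1)) (fun k ↦ ?_)
    ((tendsto_add_atTop_iff_nat 1).2 (tendsto_pow_atTop_nhds_zero_of_lt_one (norm_nonneg _) hp))
  have h : ((p : Matrix (Fin n) (Fin n) ℤ_[p]) ^ (k + 1) * C k) i j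
      = (p : ℤ_[p]) ^ (k + 1) * C k i j := by
    rw [← Nat.cast_pow, ← nsmul_eq_mul, Matrix.smul_apply, nsmul_eq_mul, Nat.cast_pow]
  rw [h, norm_mul, norm_pow]
  exact mul_le_of_le_one_right (by positivity) (PadicInt.norm_le_one _)

theorem mem_ker_glReduction_iff {p : ℕ} [Fact p.Prime] {n : ℕ} (g : GL (Fin n) ℤ_[p]) :
    g ∈ (glReduction p n).ker ↔ ∃ B : Matrix (Fin n) (Fin n) ℤ_[p],
      (g : Matrix (Fin n) (Fin n) ℤ_[p]) = 1 + (p : Matrix (Fin n) (Fin n) ℤ_[p]) * B := by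
  have key : g ∈ (glReduction p n).ker ↔ RingHom.mapMatrix (PadicInt.toZMod (p := p))
      (g : Matrix (Fin n) (Fin n) ℤ_[p]) = 1 := by
    rw [MonoidHom.mem_ker, Units.ext_iff]
    rfl
  rw [key]
  constructor
  · intro hg
    have h (i j : Fin n) : (p : ℤ_[p]) ∣ ((g : Matrix (Fin n) (Fin n) ℤ_[p]) - 1) i j := by
      rw [← Ideal.mem_span_singleton, ← PadicInt.maximalIdeal_eq_span_p, ← PadicInt.ker_toZMod,
        RingHom.mem_ker]
      change RingHom.mapMatrix (PadicInt.toZMod (p := p)) (_ - 1) i j = 0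
      rw [map_sub, hg, map_one, sub_self, Matrix.zero_apply]
    choose B hB using h
    refine ⟨Matrix.of B, ?_⟩
    rw [← sub_eq_iff_eq_add', ← nsmul_eq_mul]
    ext1 i j
    rw [hB, Matrix.smul_apply, nsmul_eq_mul, Matrix.of_apply]
  · rintro ⟨B, hB⟩
    have h0 : (p : Matrix (Fin n) (Fin n) (ZMod p)) = 0 := by
      rw [← nsmul_one]
      ext1 i j
      rw [Matrix.smul_apply, nsmul_eq_mul, CharP.cast_eq_zero, zero_mul, Matrix.zero_apply]
    rw [hB, map_add, map_mul, map_one, map_natCast, h0, zero_mul, add_zero]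

theorem tendsto_pow_prime_pow_of_mem_ker_glReduction {p : ℕ} [Fact p.Prime] {n : ℕ}
    {g : GL (Fin n) ℤ_[p]} (hg : g ∈ (glReduction p n).ker) :
    Tendsto (fun k : ℕ ↦ (g : Matrix (Fin n) (Fin n) ℤ_[p]) ^ p ^ k) atTop (𝓝 1) := by
  obtain ⟨B, hB⟩ := (mem_ker_glReduction_iff g).1 hg
  rw [hB]
  exact tendsto_pow_prime_pow_one B

theorem tendsto_pow_prime_pow_add_one_of_mem_ker_glReduction {p : ℕ} [Fact p.Prime] {n : ℕ}
    {g : GL (Fin n) ℤ_[p]} (hg : g ∈ (glReduction p n).ker) :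
    Tendsto (fun k : ℕ ↦ (g : Matrix (Fin n) (Fin n) ℤ_[p]) ^ (p ^ k + 1)) atTop (𝓝 ↑g) := by
  simpa [pow_succ] using (tendsto_pow_prime_pow_of_mem_ker_glReduction hg).mul_const ↑g

theorem sq_injective_ker_glReduction {p : ℕ} [Fact p.Prime] (hodd : Odd p) {n : ℕ} :
    Function.Injective fun g : ↥((glReduction p n).ker) ↦ g ^ 2 := by
  intro u v huv
  have hu := tendsto_pow_prime_pow_add_one_of_mem_ker_glReduction u.2
  have hv := tendsto_pow_prime_pow_add_one_of_mem_ker_glReduction v.2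
  have h : (u.1 : Matrix (Fin n) (Fin n) ℤ_[p]) ^ 2 = (v.1 : Matrix (Fin n) (Fin n) ℤ_[p]) ^ 2 :=
    congrArg (fun g : ↥((glReduction p n).ker) ↦ (g.1 : Matrix (Fin n) (Fin n) ℤ_[p])) huv
  refine Subtype.ext (Units.ext (tendsto_nhds_unique hu (hv.congr fun k ↦ ?_)))
  obtain ⟨m, hm⟩ := ((hodd.pow (n := k)).add_odd odd_one).two_dvd
  rw [hm, pow_mul, pow_mul, h]

theorem sq_surjective_ker_glReduction {p : ℕ} [Fact p.Prime] (hodd : Odd p) {n : ℕ} :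
    Function.Surjective fun g : ↥((glReduction p n).ker) ↦ g ^ 2 := by
  intro x
  have hm (k : ℕ) : ∃ m, p ^ k + 1 = m * 2 := by
    simpa [mul_comm, dvd_def] using ((hodd.pow (n := k)).add_odd odd_one).two_dvd
  choose m hm using hm
  choose B hB using fun k ↦ (mem_ker_glReduction_iff _).1 (x ^ m k).2
  have : CompactSpace (Matrix (Fin n) (Fin n) ℤ_[p]) :=
    inferInstanceAs (CompactSpace (Fin n → Fin n → ℤ_[p]))
  -- A square root of `x` is any limit point of the powers `x ^ ((p ^ k + 1) / 2)`.
  let F : Ultrafilter ℕ := hyperfilter ℕ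
  have hF : (F : Filter ℕ) ≤ atTop := Nat.hyperfilter_le_atTop
  obtain ⟨A, -, hA⟩ := isCompact_univ.ultrafilter_le_nhds (F.map B) (by simp)
  have hA : Tendsto B F (𝓝 A) := hA
  have hlim := (hA.const_mul (p : Matrix (Fin n) (Fin n) ℤ_[p])).const_add 1
  have hsq : (1 + (p : Matrix (Fin n) (Fin n) ℤ_[p]) * A) ^ 2 = x.1 := by
    refine tendsto_nhds_unique (hlim.pow 2)
      (((tendsto_pow_prime_pow_add_one_of_mem_ker_glReduction x.2).mono_left hF).congr fun k ↦ ?_)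
    rw [← hB, hm, pow_mul]
    rfl
  have hunit : IsUnit (1 + (p : Matrix (Fin n) (Fin n) ℤ_[p]) * A) :=
    (isUnit_pow_iff two_ne_zero).1 (hsq ▸ x.1.isUnit)
  exact ⟨⟨hunit.unit, (mem_ker_glReduction_iff _).2 ⟨A, rfl⟩⟩, Subtype.ext (Units.ext hsq)⟩

/-- Let `Γ = 1 + p·Mat_n(ℤ_p)` be the principal congruence subgroup of `GL_n(ℤ_p)`, i.e. the
kernel of the reduction map `GL_n(ℤ_p) → GL_n(ℤ/pℤ)`, with `p` an odd prime. Then for every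
continuous involution `θ` of `Γ`, every `x ∈ Γ` with `θ(x) = x⁻¹` is of the form
`x = g θ(g)⁻¹`. -/
theorem congruence_subgroup_cocycle_is_coboundary (p : ℕ) [Fact p.Prime] (hodd : Odd p)
    (n : ℕ) (hn : 1 ≤ n)
    (θ : ↥((glReduction p n).ker) ≃* ↥((glReduction p n).ker))
    (hθ : ∀ g, θ (θ g) = g) (hcont : Continuous ⇑θ) :
    ∀ x : ↥((glReduction p n).ker), θ x = x⁻¹ → ∃ g, x = g * (θ g)⁻¹ := by
  intro x hx
  obtain ⟨y, rfl⟩ := sq_surjective_ker_glReduction hodd x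
  have hy : θ y = y⁻¹ := sq_injective_ker_glReduction hodd (by simpa using hx)
  exact ⟨y, by simp [hy, sq]⟩
end
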